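/- arXiv:math-ph/0411019 — 3 statements merged into one kernel-verified Lean document; each statement's English description precedes it below -/
import Mathlib

section
/- Let Ω ⊆ ℝ be measurable and ω : Ω → [0,∞) measurable with ∫_Ω ω(x)·|x|^n dx < ∞ for all n ∈ ℕ, and suppose H_{N,N} := ∫_{Ω^N} Δ_N(x)² ∏_{l=1}^N ω(x_l) dx > 0. Let (π_k)_{k≥0} be the monic orthogonal polynomials for ω on Ω, i.e., real polynomials with π_k monic of degree k and ∫_Ω ω(x) π_j(x) π_k(x) dx = 0 for j ≠ k. Then for any K ≥ 1 and any pairwise distinct λ_1,…,λ_K ∈ ℂ: (1/Δ_K(λ_1,…,λ_K)) · det_{j,k=1}^K[π_{N+j−1}(λ_k)] = (1/H_{N,N}) · ∫_{Ω^N} Δ_N(x)² ∏_{l=1}^N ω(x_l) ∏_{l=1}^N ∏_{i=1}^K (λ_i − x_l) dx. -/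
open MeasureTheory Finset

/-- The Vandermonde product `∏_{j<k} (z k - z j)` for a real tuple. -/
noncomputable def vandR {n : ℕ} (z : Fin n → ℝ) : ℝ :=
  ∏ j : Fin n, ∏ k ∈ Finset.Ioi j, (z k - z j)

/-- The Vandermonde product `∏_{j<k} (z k - z j)` for a complex tuple. -/
noncomputable def vandC {n : ℕ} (z : Fin n → ℂ) : ℂ :=
  ∏ j : Fin n, ∏ k ∈ Finset.Ioi j, (z k - z j)

open Matrix in
/-- The determinant of a matrix whose top rows are functions of independent variables is
integrable. -/
theorem integrable_det_fromRows {ι κ α : Type*} [Fintype ι] [DecidableEq ι] [Fintype κ]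
    [DecidableEq κ] [MeasurableSpace α] {μ : Measure α} [SigmaFinite μ]
    {f : ι → ι ⊕ κ → α → ℂ} (hf : ∀ i a, Integrable (f i a) μ) (B : Matrix κ (ι ⊕ κ) ℂ) :
    Integrable (fun x : ι → α => (fromRows (of fun i a => f i a (x i)) B).det)
      (Measure.pi fun _ => μ) := by
  simp_rw [← det_transpose (fromRows _ B), det_apply', Fintype.prod_sum_type, transpose_apply,
    fromRows_apply_inl, fromRows_apply_inr, of_apply]
  exact integrable_finsetSum _ fun τ _ =>
    ((Integrable.fintype_prod fun i => hf i (τ (Sum.inl i))).mul_const _).const_mul _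

open Matrix in
/-- The determinant of a matrix whose top rows are functions of independent variables is
integrated row by row. -/
theorem integral_det_fromRows {ι κ α : Type*} [Fintype ι] [DecidableEq ι] [Fintype κ]
    [DecidableEq κ] [MeasurableSpace α] {μ : Measure α} [SigmaFinite μ]
    {f : ι → ι ⊕ κ → α → ℂ} (hf : ∀ i a, Integrable (f i a) μ) (B : Matrix κ (ι ⊕ κ) ℂ) :
    ∫ x : ι → α, (fromRows (of fun i a => f i a (x i)) B).det ∂Measure.pi (fun _ => μ) =
      (fromRows (of fun i a => ∫ t, f i a t ∂μ) B).det := by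
  simp_rw [← det_transpose (fromRows _ B), det_apply', Fintype.prod_sum_type, transpose_apply,
    fromRows_apply_inl, fromRows_apply_inr, of_apply]
  rw [integral_finsetSum _ fun τ _ =>
    ((Integrable.fintype_prod fun i => hf i (τ (Sum.inl i))).mul_const _).const_mul _]
  refine Finset.sum_congr rfl fun τ _ => ?_
  rw [integral_const_mul, integral_mul_const,
    integral_fintype_prod_eq_prod (fun i => f i (τ (Sum.inl i)))]

open Matrix in
/-- Andréief's identity for biorthogonal families, with extra constant rows `B`. -/
theorem integral_det_mul_det_fromRows {ι κ α : Type*} [Fintype ι] [DecidableEq ι] [Fintype κ]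
    [DecidableEq κ] [MeasurableSpace α] {μ : Measure α} [SigmaFinite μ]
    {ψ : ι → α → ℂ} {φ : ι ⊕ κ → α → ℂ} {h : ι → ℂ}
    (hint : ∀ i a, Integrable (fun t => ψ i t * φ a t) μ)
    (hl : ∀ i j, ∫ t, ψ i t * φ (Sum.inl j) t ∂μ = diagonal h i j)
    (hr : ∀ i k, ∫ t, ψ i t * φ (Sum.inr k) t ∂μ = 0) (B : Matrix κ (ι ⊕ κ) ℂ) :
    ∫ x : ι → α, (of fun i j => ψ j (x i)).det * (fromRows (of fun i a => φ a (x i)) B).det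
        ∂Measure.pi (fun _ => μ) =
      (Fintype.card ι).factorial * (∏ i, h i) * (B.submatrix id Sum.inr).det := by
  have expand (x : ι → α) :
      (of fun i j => ψ j (x i)).det * (fromRows (of fun i a => φ a (x i)) B).det =
        ∑ σ : Equiv.Perm ι, (Equiv.Perm.sign σ : ℂ) *
          (fromRows (of fun i a => ψ (σ i) (x i) * φ a (x i)) B).det := by
    rw [← det_transpose, det_apply', Finset.sum_mul]
    refine Finset.sum_congr rfl fun σ _ => ?_
    rw [mul_assoc]
    congr 1
    have := det_mul_column (Sum.elim (fun i => ψ (σ i) (x i)) 1)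
      (fromRows (of fun i a => φ a (x i)) B)
    simp only [Fintype.prod_sum_type, Sum.elim_inl, Sum.elim_inr, Pi.one_apply,
      Finset.prod_const_one, mul_one] at this
    simp only [transpose_apply, of_apply]
    rw [← this]
    congr 1
    ext (i | k) a <;> simp
  have term (σ : Equiv.Perm ι) :
      (fromRows (of fun i a => ∫ t, ψ (σ i) t * φ a t ∂μ) B).det =
        (Equiv.Perm.sign σ : ℂ) * ((∏ i, h i) * (B.submatrix id Sum.inr).det) := by
    have : fromRows (of fun i a => ∫ t, ψ (σ i) t * φ a t ∂μ) B =
        fromBlocks ((diagonal h).submatrix σ id) 0 (B.submatrix id Sum.inl)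
          (B.submatrix id Sum.inr) := by
      ext (i | k) (j | l) <;> simp [hl, hr]
    rw [this, det_fromBlocks_zero₁₂, det_permute, det_diagonal, mul_assoc]
  simp_rw [expand]
  rw [integral_finsetSum _ fun σ _ =>
    (integrable_det_fromRows (fun i a => hint (σ i) a) B).const_mul _]
  have sign_sq (σ : Equiv.Perm ι) : (Equiv.Perm.sign σ : ℂ) * (Equiv.Perm.sign σ : ℂ) = 1 := by
    rcases Int.units_eq_one_or (Equiv.Perm.sign σ) with hσ | hσ <;> simp [hσ]
  simp_rw [integral_const_mul, integral_det_fromRows (fun i a => hint (_ : ι) a), term,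
    ← mul_assoc, sign_sq]
  simp [Fintype.card_perm, mul_assoc]

theorem vandC_append {N K : ℕ} (x : Fin N → ℂ) (y : Fin K → ℂ) :
    vandC (Fin.append x y) = vandC x * vandC y * ∏ l, ∏ i, (y i - x l) := by
  have key {n : ℕ} (z : Fin n → ℂ) :
      vandC z = ∏ j, ∏ k, if j < k then z k - z j else 1 := by
    simp [vandC, ← Finset.prod_filter, Finset.filter_lt_eq_Ioi]
  have h1 (i : Fin N) (j : Fin K) : Fin.castAdd K i < Fin.natAdd N j := by
    simp [Fin.lt_def]; omega
  rw [key, key x, key y, Fin.prod_univ_add]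
  simp only [Fin.prod_univ_add, Fin.append_left, Fin.append_right, h1, (h1 _ _).not_gt,
    if_true, if_false, Finset.prod_const_one, one_mul, Finset.prod_mul_distrib,
    (Fin.strictMono_castAdd K).lt_iff_lt, Fin.natAdd_lt_natAdd_iff]
  ring

theorem vandC_ofReal {n : ℕ} (x : Fin n → ℝ) : vandC (fun l => (x l : ℂ)) = vandR x := by
  simp [vandC, vandR]

/-- Monic polynomials of degrees `0, …, n - 1` have the Vandermonde product as their evaluation
determinant. -/
theorem det_aeval_eq_vandC {n : ℕ} {P : ℕ → Polynomial ℝ} (hmonic : ∀ k, (P k).Monic)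
    (hdeg : ∀ k, (P k).natDegree = k) (z : Fin n → ℂ) :
    (Matrix.of fun i j : Fin n => Polynomial.aeval (z i) (P j)).det = vandC z := by
  have := Matrix.det_eval_matrixOfPolynomials_eq_det_vandermonde z
    (fun i => (P i).map (algebraMap ℝ ℂ)) (fun i => by simp [hdeg])
    (fun i => (hmonic i).map _)
  simp only [Polynomial.eval_map_algebraMap] at this
  rw [← this, Matrix.det_vandermonde, vandC]

theorem det_fromRows_aeval {N K : ℕ} {P : ℕ → Polynomial ℝ} (hmonic : ∀ k, (P k).Monic)
    (hdeg : ∀ k, (P k).natDegree = k) (x : Fin N → ℂ) (y : Fin K → ℂ) :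
    (Matrix.fromRows
      (Matrix.of fun i a => Polynomial.aeval (x i) (P (finSumFinEquiv (m := N) (n := K) a)))
      (Matrix.of fun k a => Polynomial.aeval (y k) (P (finSumFinEquiv a)))).det =
      vandC x * vandC y * ∏ l, ∏ i, (y i - x l) := by
  rw [← vandC_append, ← det_aeval_eq_vandC hmonic hdeg,
    ← Matrix.det_submatrix_equiv_self finSumFinEquiv]
  congr 1
  ext (i | k) a <;> simp

theorem integrableOn_weight_mul_eval {Ω : Set ℝ} {ω : ℝ → ℝ} (hmeas : Measurable ω)
    (hmom : ∀ n : ℕ, IntegrableOn (fun x => ω x * |x| ^ n) Ω) (p : Polynomial ℝ) :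
    IntegrableOn (fun x => ω x * p.eval x) Ω := by
  simp_rw [Polynomial.eval_eq_sum_range, Finset.mul_sum]
  refine integrable_finsetSum _ fun n _ => ?_
  have : IntegrableOn (fun x => ω x * x ^ n) Ω :=
    Integrable.mono (hmom n) (by fun_prop) (ae_of_all _ fun x => by simp)
  exact (this.const_mul (p.coeff n)).congr (ae_of_all _ fun x => by simp only; ring)

/-- The Brézin–Hikami duality before normalization. -/
theorem integral_vandR_sq_mul_prod {Ω : Set ℝ} {ω : ℝ → ℝ} (hmeas : Measurable ω)
    (hmom : ∀ n : ℕ, IntegrableOn (fun x => ω x * |x| ^ n) Ω)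
    {P : ℕ → Polynomial ℝ} (hmonic : ∀ k, (P k).Monic) (hdeg : ∀ k, (P k).natDegree = k)
    (horth : ∀ j k, j ≠ k → (∫ x in Ω, ω x * ((P j).eval x * (P k).eval x)) = 0)
    (N : ℕ) {K : ℕ} (y : Fin K → ℂ) :
    vandC y * ∫ x in Set.univ.pi (fun _ : Fin N => Ω),
        ((vandR x ^ 2 * ∏ l, ω (x l) : ℝ) : ℂ) * ∏ l : Fin N, ∏ i : Fin K, (y i - (x l : ℂ)) =
      (N.factorial * ∏ i : Fin N, ((∫ t in Ω, ω t * ((P i).eval t * (P i).eval t) : ℝ) : ℂ)) *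
        (Matrix.of fun j k : Fin K => Polynomial.aeval (y k) (P (N + (j : ℕ)))).det := by
  have aeval_real (p : Polynomial ℝ) (t : ℝ) :
      Polynomial.aeval (t : ℂ) p = ((p.eval t : ℝ) : ℂ) :=
    Polynomial.aeval_algebraMap_apply_eq_algebraMap_eval t p
  have pairing (j k : ℕ) (t : ℝ) :
      (ω t : ℂ) * Polynomial.aeval (t : ℂ) (P j) * Polynomial.aeval (t : ℂ) (P k) =
        ((ω t * ((P j).eval t * (P k).eval t) : ℝ) : ℂ) := by
    rw [aeval_real, aeval_real]; push_cast; ring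
  have andreief := integral_det_mul_det_fromRows (μ := volume.restrict Ω)
    (ψ := fun i : Fin N => fun t : ℝ => (ω t : ℂ) * Polynomial.aeval (t : ℂ) (P i))
    (φ := fun a : Fin N ⊕ Fin K => fun t : ℝ =>
      Polynomial.aeval (t : ℂ) (P (finSumFinEquiv a)))
    (h := fun i => ((∫ t in Ω, ω t * ((P i).eval t * (P i).eval t) : ℝ) : ℂ))
    (fun i a => by
      simp_rw [pairing, ← Polynomial.eval_mul]
      exact (integrableOn_weight_mul_eval hmeas hmom _).ofReal)
    (fun i j => by
      simp_rw [pairing, integral_complex_ofReal]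
      rcases eq_or_ne i j with rfl | hij
      · simp
      · simpa [hij] using horth i j (by simpa [Fin.ext_iff] using hij))
    (fun i k => by
      simp_rw [pairing, integral_complex_ofReal]
      simpa using horth i (N + k) (by omega))
    (Matrix.of fun k a => Polynomial.aeval (y k) (P (finSumFinEquiv a)))
  have integrand (x : Fin N → ℝ) :
      (Matrix.of fun i j : Fin N => (ω (x i) : ℂ) * Polynomial.aeval (x i : ℂ) (P j)).det =
        vandR x * ∏ l, (ω (x l) : ℂ) := by
    rw [← vandC_ofReal, ← det_aeval_eq_vandC hmonic hdeg, mul_comm]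
    exact Matrix.det_mul_column (fun i => (ω (x i) : ℂ))
      (Matrix.of fun i j : Fin N => Polynomial.aeval (x i : ℂ) (P j))
  simp_rw [integrand, det_fromRows_aeval hmonic hdeg (fun l => ((_ : Fin N → ℝ) l : ℂ)),
    vandC_ofReal] at andreief
  rw [Fintype.card_fin, ← Matrix.det_transpose] at andreief
  rw [volume_pi, Measure.restrict_pi_pi, ← integral_const_mul]
  refine Eq.trans (integral_congr_ae (ae_of_all _ fun x => ?_)) (andreief.trans ?_)
  · push_cast; ring
  · congr 2

/-- Brézin–Hikami duality.  The ensemble average of a product of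
characteristic polynomials equals a determinant of monic orthogonal polynomials:
`(1/Δ_K(λ)) det[π_{N+j-1}(λ_k)] = (1/H_{N,N}) ∫_{Ω^N} Δ_N(x)² ∏ ω(x_l) ∏∏ (λ_i - x_l) dx`. -/
theorem brezin_hikami_duality
    (Ω : Set ℝ) (hΩ : MeasurableSet Ω) (ω : ℝ → ℝ) (hmeas : Measurable ω)
    (hnonneg : ∀ x ∈ Ω, 0 ≤ ω x)
    (hmom : ∀ n : ℕ, IntegrableOn (fun x => ω x * |x| ^ n) Ω)
    (N : ℕ)
    (hHpos : 0 < ∫ x in Set.univ.pi (fun _ : Fin N => Ω),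
        vandR x ^ 2 * ∏ l, ω (x l))
    (P : ℕ → Polynomial ℝ)
    (hmonic : ∀ k, (P k).Monic) (hdeg : ∀ k, (P k).natDegree = k)
    (horth : ∀ j k, j ≠ k → (∫ x in Ω, ω x * ((P j).eval x * (P k).eval x)) = 0)
    (K : ℕ) (hK : 1 ≤ K) (lam : Fin K → ℂ) (hlam : Function.Injective lam) :
    (vandC lam)⁻¹ *
        Matrix.det (Matrix.of fun j k : Fin K =>
          Polynomial.aeval (lam k) (P (N + (j : ℕ))))
      = ((∫ x in Set.univ.pi (fun _ : Fin N => Ω),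
            vandR x ^ 2 * ∏ l, ω (x l) : ℝ) : ℂ)⁻¹ *
          ∫ x in Set.univ.pi (fun _ : Fin N => Ω),
            ((vandR x ^ 2 * ∏ l, ω (x l) : ℝ) : ℂ) *
              ∏ l : Fin N, ∏ i : Fin K, (lam i - (x l : ℂ)) := by
  have dual := integral_vandR_sq_mul_prod hmeas hmom hmonic hdeg horth N lam
  have norm := integral_vandR_sq_mul_prod hmeas hmom hmonic hdeg horth N (K := 0) Fin.elim0
  simp only [vandC, Finset.univ_eq_empty, Finset.prod_empty, Finset.prod_const_one, mul_one,
    one_mul, Matrix.det_isEmpty, integral_complex_ofReal] at norm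
  rw [← norm] at dual
  have hV : vandC lam ≠ 0 := by
    simp only [vandC, Finset.prod_ne_zero_iff, Finset.mem_Ioi, sub_ne_zero]
    exact fun j _ k hjk => hlam.ne hjk.ne'
  have hH := Complex.ofReal_ne_zero.mpr hHpos.ne'
  rw [inv_mul_eq_iff_eq_mul₀ hV, mul_left_comm, dual, inv_mul_cancel_left₀ hH]
end

section
/- Let K, n, r, s ∈ ℕ with n ≥ 1 and r + n + s = K. Let v_1,…,v_r, w_1,…,w_s ∈ ℂ^K be fixed column vectors, let μ ∈ ℝ, and let c : ℝ → ℂ^K be (n−1)-times continuously differentiable in a neighborhood of μ. Then the iterated limit (taking λ_1 → μ innermost first, then λ_2 → μ, …, finally λ_n → μ) of (∏_{l=1}^{n−1} l!) · det[v_1 … v_r, c(λ_1), …, c(λ_n), w_1 … w_s] / Δ_n(λ_1,…,λ_n), as each λ_p → μ through values with λ_1,…,λ_n pairwise distinct, exists and equals det[v_1 … v_r, c(μ), c′(μ), c″(μ), …, c^{(n−1)}(μ), w_1 … w_s]. -/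
open Filter

open Topology

section TaylorQuotient

variable {E : Type*} [NormedAddCommGroup E] [NormedSpace ℝ E]

/-- The `k`-th Taylor coefficient `f^{(k)}(a) / k!`. -/
noncomputable def taylorCoefficient (f : ℝ → E) (a : ℝ) (k : ℕ) : E :=
  (k.factorial : ℝ)⁻¹ • iteratedDeriv k f a

/-- The quotient `(f x - ∑_{i<p} (x - a)^i f^{(i)}(a) / i!) / (x - a)^p`, extended to `x = a`
by the `p`-th Taylor coefficient. -/
noncomputable def taylorQuotient (f : ℝ → E) (a : ℝ) : ℕ → ℝ → E
  | 0 => f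
  | p + 1 => Function.update (slope (taylorQuotient f a p) a) a (taylorCoefficient f a (p + 1))

theorem taylorQuotient_self (f : ℝ → E) (a : ℝ) (p : ℕ) :
    taylorQuotient f a p a = taylorCoefficient f a p := by
  cases p <;> simp [taylorQuotient, taylorCoefficient]

theorem taylorQuotient_succ_of_ne (f : ℝ → E) (p : ℕ) {a x : ℝ} (hx : x ≠ a) :
    taylorQuotient f a (p + 1) x = slope (taylorQuotient f a p) a x := by
  simp [taylorQuotient, hx]

theorem taylorQuotient_of_ne (f : ℝ → E) (p : ℕ) {a x : ℝ} (hx : x ≠ a) :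
    taylorQuotient f a p x =
      ((x - a) ^ p)⁻¹ • (f x - ∑ i ∈ Finset.range p, (x - a) ^ i • taylorCoefficient f a i) := by
  have hxa : x - a ≠ 0 := sub_ne_zero.2 hx
  induction p with
  | zero => simp [taylorQuotient]
  | succ p ih =>
    rw [taylorQuotient_succ_of_ne f p hx, slope_def_module, ih, taylorQuotient_self,
      Finset.sum_range_succ, ← sub_sub, smul_sub, smul_sub ((x - a) ^ (p + 1))⁻¹, smul_smul,
      smul_smul, pow_succ]
    congr 2 <;> field_simp

theorem continuousAt_taylorQuotient {f : ℝ → E} {a : ℝ} {p : ℕ} (hf : ContDiffAt ℝ p f a) :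
    ContinuousAt (taylorQuotient f a p) a := by
  obtain ⟨u, hu, hfu⟩ := hf.contDiffOn le_rfl (by simp)
  obtain ⟨ε, hε, hεu⟩ := Metric.mem_nhds_iff.1 hu
  have ha : a ∈ Metric.ball a ε := Metric.mem_ball_self hε
  have h := taylor_tendsto (convex_ball a ε) ha (hfu.mono hεu)
  rw [Metric.isOpen_ball.nhdsWithin_eq ha] at h
  rw [continuousAt_iff_punctured_nhds, taylorQuotient_self]
  have h' := (h.mono_left (nhdsWithin_le_nhds (s := {a}ᶜ))).add_const (taylorCoefficient f a p)
  rw [zero_add] at h'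
  refine h'.congr' ?_
  filter_upwards [self_mem_nhdsWithin] with x hx
  have hxa : (x - a) ^ p ≠ 0 := pow_ne_zero _ (sub_ne_zero.2 hx)
  have hT : taylorWithinEval f p (Metric.ball a ε) a x =
      ∑ i ∈ Finset.range (p + 1), (x - a) ^ i • taylorCoefficient f a i := by
    rw [taylor_within_apply]
    refine Finset.sum_congr rfl fun i hi => ?_
    have hi : i ≤ p := Nat.lt_succ_iff.1 (Finset.mem_range.1 hi)
    rw [iteratedDerivWithin_eq_iteratedDeriv Metric.isOpen_ball.uniqueDiffOn
      (hf.of_le (by exact_mod_cast hi)) ha, taylorCoefficient, smul_smul, mul_comm]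
  rw [taylorQuotient_of_ne f p hx, hT, Finset.sum_range_succ, ← sub_sub,
    smul_sub ((x - a) ^ p)⁻¹ (f x - _), smul_smul, inv_mul_cancel₀ hxa, one_smul, sub_add_cancel]

theorem tendsto_slope_taylorQuotient {f : ℝ → E} {a b : ℝ} {p : ℕ}
    (hf : ContDiffAt ℝ (p + 1 : ℕ) f a) :
    Tendsto (fun x => slope (taylorQuotient f a p) x b) (𝓝[{b}ᶜ] a)
      (𝓝 (taylorQuotient f a (p + 1) b)) := by
  rcases eq_or_ne b a with rfl | hb
  · have h := (continuousAt_taylorQuotient hf).tendsto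
    refine (h.mono_left nhdsWithin_le_nhds).congr' ?_
    filter_upwards [self_mem_nhdsWithin] with x hx
    rw [taylorQuotient_succ_of_ne f p hx, slope_comm]
  · have hcont : ContinuousAt (taylorQuotient f a p) a :=
      continuousAt_taylorQuotient (hf.of_le (by exact_mod_cast p.le_succ))
    rw [taylorQuotient_succ_of_ne f p hb]
    simp only [slope_def_module]
    have : ContinuousAt (fun x => (b - x)⁻¹ • (taylorQuotient f a p b - taylorQuotient f a p x)) a :=
      ((continuousAt_const.sub continuousAt_id).inv₀ (sub_ne_zero.2 hb)).smul
        (continuousAt_const.sub hcont)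
    exact this.tendsto.mono_left nhdsWithin_le_nhds

end TaylorQuotient

section BlockDeterminant

variable {K n r s : ℕ}

theorem sub_sub_lt_of_not_lt (hK : r + n + s = K) (j : Fin K) (h : ¬ (j : ℕ) < r)
    (h2 : ¬ (j : ℕ) - r < n) : (j : ℕ) - r - n < s := by
  omega

/-- The matrix whose columns are `v`, followed by `col`, followed by `w`. -/
def blockMatrix (hK : r + n + s = K) (v : Fin r → Fin K → ℂ) (w : Fin s → Fin K → ℂ)
    (col : Fin n → Fin K → ℂ) : Matrix (Fin K) (Fin K) ℂ :=
  Matrix.of fun (row j : Fin K) =>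
    if h : (j : ℕ) < r then v ⟨j, h⟩ row
    else if h2 : (j : ℕ) - r < n then col ⟨(j : ℕ) - r, h2⟩ row
    else w ⟨(j : ℕ) - r - n, sub_sub_lt_of_not_lt hK j h h2⟩ row

variable (hK : r + n + s = K) (v : Fin r → Fin K → ℂ) (w : Fin s → Fin K → ℂ)

theorem continuous_det_blockMatrix :
    Continuous fun col : Fin n → Fin K → ℂ => (blockMatrix hK v w col).det := by
  refine Continuous.matrix_det (continuous_matrix fun i j => ?_)
  simp only [blockMatrix, Matrix.of_apply]
  split_ifs <;> fun_prop

theorem det_blockMatrix_smul (a : Fin n → ℝ) (col : Fin n → Fin K → ℂ) :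
    (blockMatrix hK v w fun i => a i • col i).det =
      (∏ i, (a i : ℂ)) * (blockMatrix hK v w col).det := by
  let b : Fin K → ℂ := fun j =>
    if (j : ℕ) < r then 1 else if h : (j : ℕ) - r < n then (a ⟨(j : ℕ) - r, h⟩ : ℂ) else 1
  have hb : ∏ j, b j = ∏ i, (a i : ℂ) := by
    subst hK
    simp [b, Fin.prod_univ_add, Nat.add_assoc]
  rw [← hb, ← Matrix.det_mul_row]
  congr 1
  ext i j
  simp only [blockMatrix, b, Matrix.of_apply]
  split_ifs <;> simp

theorem det_blockMatrix_add_smul (k : Fin n) (a : Fin n → ℝ) (ha : a k = 0)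
    (col : Fin n → Fin K → ℂ) :
    (blockMatrix hK v w fun i => col i + a i • col k).det = (blockMatrix hK v w col).det := by
  rw [← Matrix.det_transpose, ← Matrix.det_transpose (blockMatrix hK v w col)]
  refine Matrix.det_eq_of_forall_row_eq_smul_add_const
    (fun j : Fin K => if (j : ℕ) < r then 0
      else if h : (j : ℕ) - r < n then (a ⟨(j : ℕ) - r, h⟩ : ℂ) else 0)
    ⟨r + k, by omega⟩ (by simp [ha]) fun j i => ?_
  have hk : blockMatrix hK v w col i ⟨r + k, by omega⟩ = col k i := by simp [blockMatrix]
  simp only [Matrix.transpose_apply, hk]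
  simp only [blockMatrix, Matrix.of_apply]
  split_ifs <;> simp

end BlockDeterminant

/-- The Vandermonde product of the variables with index at least `p`. -/
noncomputable def tailVandermonde {n : ℕ} (p : ℕ) (z : Fin n → ℝ) : ℝ :=
  ∏ j ∈ ({j : Fin n | p ≤ (j : ℕ)} : Finset (Fin n)), ∏ k ∈ Finset.Ioi j, (z k - z j)

theorem tailVandermonde_update {n : ℕ} (p : Fin n) (z : Fin n → ℝ) (x : ℝ) :
    tailVandermonde p (Function.update z p x) =
      (∏ k ∈ Finset.Ioi p, (z k - x)) * tailVandermonde (p + 1) z := by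
  have hset : ({j : Fin n | (p : ℕ) ≤ j} : Finset (Fin n)) =
      insert p ({j : Fin n | (p : ℕ) + 1 ≤ j} : Finset (Fin n)) := by
    ext j
    simp only [Finset.mem_filter, Finset.mem_univ, true_and, Finset.mem_insert, Fin.ext_iff]
    omega
  rw [tailVandermonde, hset, Finset.prod_insert (by simp), tailVandermonde]
  congr 1
  · refine Finset.prod_congr rfl fun k hk => ?_
    rw [Function.update_of_ne (Finset.mem_Ioi.1 hk).ne', Function.update_self]
  · refine Finset.prod_congr rfl fun j hj => Finset.prod_congr rfl fun k hk => ?_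
    have hpj : p < j := (Finset.mem_filter.1 hj).2
    rw [Function.update_of_ne hpj.ne',
      Function.update_of_ne (hpj.trans (Finset.mem_Ioi.1 hk)).ne']

section PartialLimit

variable {K n r s : ℕ} (hK : r + n + s = K) (v : Fin r → Fin K → ℂ) (w : Fin s → Fin K → ℂ)
  (c : ℝ → Fin K → ℂ) (μ : ℝ)

/-- The columns left after the first `p` variables have tended to `μ`. -/
noncomputable def confluentColumns (p : ℕ) (lam : Fin n → ℝ) (i : Fin n) : Fin K → ℂ :=
  if (i : ℕ) < p then taylorCoefficient c μ i else taylorQuotient c μ p (lam i)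

/-- The Vandermonde-divided determinant, without the factorial normalisation, after the first `p`
variables have tended to `μ`. -/
noncomputable def confluentQuotient (p : ℕ) (lam : Fin n → ℝ) : ℂ :=
  (blockMatrix hK v w (confluentColumns c μ p lam)).det / (tailVandermonde p lam : ℂ)

/-- The columns obtained from `confluentColumns` by eliminating with the column of index `p`. -/
noncomputable def eliminatedColumns (p : Fin n) (lam : Fin n → ℝ) (x : ℝ) (i : Fin n) :
    Fin K → ℂ :=
  if i < p then taylorCoefficient c μ i
  else if i = p then taylorQuotient c μ p x
  else slope (taylorQuotient c μ p) x (lam i)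

theorem confluentQuotient_update (p : Fin n) (lam : Fin n → ℝ) {x : ℝ}
    (hx : ∀ j, p < j → x ≠ lam j) :
    confluentQuotient hK v w c μ p (Function.update lam p x) =
      (blockMatrix hK v w (eliminatedColumns c μ p lam x)).det /
        (tailVandermonde ((p : ℕ) + 1) lam : ℂ) := by
  let b : Fin n → ℝ := fun i => if p < i then lam i - x else 1
  let a : Fin n → ℝ := fun i => if p < i then 1 else 0
  have hcol : confluentColumns c μ p (Function.update lam p x) = fun i =>
      b i • eliminatedColumns c μ p lam x i + a i • (b p • eliminatedColumns c μ p lam x p) := by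
    funext i
    rcases lt_trichotomy i p with h | rfl | h
    · simp [confluentColumns, eliminatedColumns, a, b, h, h.not_gt]
    · simp [confluentColumns, eliminatedColumns, a, b]
    · have h' : ¬ (i : ℕ) < p := h.not_gt
      simp [confluentColumns, eliminatedColumns, a, b, h, h', h.not_gt, h.ne', sub_smul_slope]
  have hb : ∏ i, (b i : ℂ) = ((∏ k ∈ Finset.Ioi p, (lam k - x) : ℝ) : ℂ) := by
    rw [← Complex.ofReal_prod, Finset.prod_ite, Finset.prod_const_one, mul_one]
    congr 2
    ext; simp
  have hne : ((∏ k ∈ Finset.Ioi p, (lam k - x) : ℝ) : ℂ) ≠ 0 := by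
    exact_mod_cast Finset.prod_ne_zero_iff.2 fun k hk =>
      sub_ne_zero.2 (hx k (Finset.mem_Ioi.1 hk)).symm
  rw [confluentQuotient, hcol,
    det_blockMatrix_add_smul hK v w p a (by simp [a])
      fun i => b i • eliminatedColumns c μ p lam x i,
    det_blockMatrix_smul, hb, tailVandermonde_update, Complex.ofReal_mul,
    mul_div_mul_left _ _ hne]

theorem tendsto_confluentQuotient (hc : ContDiffAt ℝ (n - 1 : ℕ) c μ) (p : Fin n)
    (lam : Fin n → ℝ) :
    Tendsto (fun x => confluentQuotient hK v w c μ p (Function.update lam p x))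
      (𝓝[{x | ∀ j, p < j → x ≠ lam j}] μ)
      (𝓝 (confluentQuotient hK v w c μ ((p : ℕ) + 1) lam)) := by
  have hcol : Tendsto (fun x => eliminatedColumns c μ p lam x)
      (𝓝[{x | ∀ j, p < j → x ≠ lam j}] μ) (𝓝 (confluentColumns c μ ((p : ℕ) + 1) lam)) := by
    refine tendsto_pi_nhds.2 fun i => ?_
    rcases lt_trichotomy i p with h | rfl | h
    · have h' : (i : ℕ) < p + 1 := Nat.lt_succ_of_lt h
      simp only [eliminatedColumns, confluentColumns, h, h', if_true]
      exact tendsto_const_nhds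
    · simp only [eliminatedColumns, confluentColumns, lt_irrefl, Nat.lt_succ_self, if_true,
        if_false]
      rw [← taylorQuotient_self]
      have hi : (i : ℕ) ≤ n - 1 := by omega
      exact (continuousAt_taylorQuotient (hc.of_le (by exact_mod_cast hi))).tendsto.mono_left
        nhdsWithin_le_nhds
    · have h' : ¬ (i : ℕ) < p + 1 := by simpa using Nat.succ_le_of_lt h
      simp only [eliminatedColumns, confluentColumns, h.not_gt, h.ne', h', if_false]
      have hp : (p : ℕ) + 1 ≤ n - 1 := by omega
      refine (tendsto_slope_taylorQuotient (hc.of_le (by exact_mod_cast hp))).mono_left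
        (nhdsWithin_mono _ fun x hx => hx i h)
  refine Tendsto.congr' ?_
    (((continuous_det_blockMatrix hK v w).tendsto _).comp hcol |>.div_const _)
  filter_upwards [self_mem_nhdsWithin] with x hx
  exact (confluentQuotient_update hK v w c μ p lam hx).symm

end PartialLimit

/-- confluent limit of a Vandermonde-divided determinant.
With `K = r + n + s` columns `v_1,…,v_r, c(λ_1),…,c(λ_n), w_1,…,w_s`, the iterated limit
(first `λ_1 → μ`, …, finally `λ_n → μ`, through pairwise distinct values) of
`(∏_{l=1}^{n-1} l!)·det[v, c(λ_1),…,c(λ_n), w]/Δ_n(λ)` exists and equals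
`det[v, c(μ), c'(μ), …, c^{(n-1)}(μ), w]`.  The iterated limit is encoded by a sequence of
functions `T p` ("after the first `p` limits"), each step being a genuine filter limit. -/
theorem confluent_vandermonde_limit
    (K n r s : ℕ) (hn : 1 ≤ n) (hK : r + n + s = K)
    (v : Fin r → Fin K → ℂ) (w : Fin s → Fin K → ℂ) (μ : ℝ)
    (c : ℝ → Fin K → ℂ)
    (U : Set ℝ) (hU : U ∈ nhds μ) (hc : ContDiffOn ℝ (n - 1 : ℕ) c U) :
    ∃ T : ℕ → (Fin n → ℝ) → ℂ,
      -- `T 0` is the original Vandermonde-divided determinant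
      (∀ lam : Fin n → ℝ,
          T 0 lam =
            (∏ l ∈ Finset.Icc 1 (n - 1), (l.factorial : ℂ)) *
              Matrix.det (Matrix.of fun (row j : Fin K) =>
                if h : (j : ℕ) < r then v ⟨j, h⟩ row
                else if h2 : (j : ℕ) - r < n then c (lam ⟨(j : ℕ) - r, h2⟩) row
                else w ⟨(j : ℕ) - r - n, by omega⟩ row) /
              (vandR lam : ℂ)) ∧
      -- at step `p`, the limit `λ_p → μ` (through values distinct from the later,
      -- pairwise distinct, variables) of `T p` exists and equals `T (p+1)`
      (∀ p : Fin n, ∀ lam : Fin n → ℝ,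
          (∀ j k : Fin n, (p : ℕ) < (j : ℕ) → (p : ℕ) < (k : ℕ) → j ≠ k → lam j ≠ lam k) →
          Tendsto (fun x : ℝ => T p (Function.update lam p x))
            (nhdsWithin μ {x : ℝ | ∀ j : Fin n, (p : ℕ) < (j : ℕ) → x ≠ lam j})
            (nhds (T ((p : ℕ) + 1) lam))) ∧
      -- the final value is the determinant with confluent (derivative) columns
      (∀ lam : Fin n → ℝ,
          T n lam =
            Matrix.det (Matrix.of fun (row j : Fin K) =>
              if h : (j : ℕ) < r then v ⟨j, h⟩ row
              else if h2 : (j : ℕ) - r < n then iteratedDeriv ((j : ℕ) - r) c μ row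
              else w ⟨(j : ℕ) - r - n, by omega⟩ row)) := by
  have hcμ : ContDiffAt ℝ (n - 1 : ℕ) c μ := hc.contDiffAt hU
  refine ⟨fun p lam => (∏ l ∈ Finset.Icc 1 (n - 1), (l.factorial : ℂ)) *
    confluentQuotient hK v w c μ p lam, fun lam => ?_, fun p lam _ => ?_, fun lam => ?_⟩
  · have hcol : confluentColumns c μ 0 lam = fun i => c (lam i) := by
      funext i
      simp [confluentColumns, taylorQuotient]
    simp only [confluentQuotient, hcol, mul_div_assoc]
    simp [blockMatrix, tailVandermonde, vandR]
  · exact (tendsto_confluentQuotient hK v w c μ hcμ p lam).const_mul _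
  · have hcol : confluentColumns c μ n lam = fun i : Fin n =>
        ((i : ℕ).factorial : ℝ)⁻¹ • iteratedDeriv (i : ℕ) c μ := by
      funext i
      simp [confluentColumns, taylorCoefficient]
    have htail : tailVandermonde n lam = 1 := by
      simp [tailVandermonde, Finset.filter_false_of_mem]
    have hfact : ∏ l ∈ Finset.Icc 1 (n - 1), (l.factorial : ℂ) =
        ∏ i : Fin n, ((i : ℕ).factorial : ℂ) := by
      obtain ⟨m, rfl⟩ : ∃ m, n = m + 1 := ⟨n - 1, by omega⟩
      rw [Fin.prod_univ_eq_prod_range (fun l => (l.factorial : ℂ)), Finset.prod_range_succ',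
        Nat.factorial_zero, Nat.cast_one, mul_one, Finset.range_eq_Ico,
        Finset.prod_Ico_add' (fun l => (l.factorial : ℂ)) 0 m 1]
      rfl
    simp only [confluentQuotient]
    rw [hcol, det_blockMatrix_smul, htail, hfact, Complex.ofReal_one, div_one,
      ← mul_assoc, ← Finset.prod_mul_distrib, Finset.prod_eq_one, one_mul]
    · rfl
    · intro i _
      simp [Nat.factorial_ne_zero]
end

section
/- Let Ω ⊆ ℝ be measurable and ω_N : Ω → (0,∞) measurable with all moments ∫_Ω ω_N(x)|x|^n dx finite, and let (π_k^{(N)})_{k≥0} be the monic orthogonal polynomials for ω_N on Ω. Let m ≥ 1, q = (q_1,…,q_m) with each q_i ∈ ℕ, q_i ≥ 1, τ(i) := Σ_{l=1}^{i−1} 2q_l, |q| := q_1+⋯+q_m. Let ζ_N : ℝ → ℝ be smooth and nowhere vanishing, and set r_{N+j−1} := π_{N+j−1}^{(N)}/ζ_N for j = 1,…,2|q|. Then for any pairwise distinct μ_1,…,μ_m ∈ ℝ: H_{N,N,m,q}(μ)/H_{N,N} = ∏_{1≤j<k≤m}(μ_k − μ_j)^{−4 q_j q_k} · ∏_{i=1}^m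 [ ζ_N(μ_i)^{2q_i} / ∏_{l=1}^{2q_i−1} l! ] · det D, where D is the 2|q| × 2|q| matrix with rows indexed by j = 1,…,2|q| and columns indexed by pairs (i, l_i), 1 ≤ i ≤ m, 1 ≤ l_i ≤ 2q_i (ordered lexicographically), with ((i,l_i), j) entry (d^{l_i−1}/dμ_i^{l_i−1}) r_{N+j−1}(μ_i). -/
open MeasureTheory Finset

open Polynomial in
/-- Evaluating linear functionals on monic polynomials of degrees `0, …, n - 1` gives a matrix whose
determinant does not depend on the polynomials. -/
theorem det_linearMap_monic_eq {R : Type*} [CommRing R] {n : ℕ} (φ : Fin n → R[X] →ₗ[R] R)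
    (p : Fin n → R[X]) (hdeg : ∀ j, (p j).natDegree = j) (hp : ∀ j, (p j).Monic) :
    Matrix.det (Matrix.of fun i j => φ i (p j)) =
      Matrix.det (Matrix.of fun i j : Fin n => φ i (X ^ (j : ℕ))) := by
  have h : (Matrix.of fun i j => φ i (p j)) =
      (Matrix.of fun i j : Fin n => φ i (X ^ (j : ℕ))) *
        Matrix.of (fun i j : Fin n => (p j).coeff i) := by
    ext i j
    have hj : (p j).natDegree < n := (hdeg j).trans_lt j.2
    conv_lhs => rw [Matrix.of_apply, as_sum_range' (p j) n hj]
    simp only [Matrix.mul_apply, Matrix.of_apply, map_sum]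
    rw [← Fin.sum_univ_eq_sum_range (fun k => φ i (monomial k ((p j).coeff k)))]
    refine Finset.sum_congr rfl fun k _ => ?_
    rw [← C_mul_X_pow_eq_monomial, ← smul_eq_C_mul, map_smul, smul_eq_mul, mul_comm]
  rw [h, Matrix.det_mul, Matrix.det_matrixOfPolynomials p hdeg hp, mul_one]

open Polynomial in
theorem det_linearMap_monic_congr {R ι : Type*} [CommRing R] [Fintype ι] [DecidableEq ι] {n : ℕ}
    (e : ι ≃ Fin n) (φ : ι → R[X] →ₗ[R] R) (p p' : ι → R[X])
    (hdeg : ∀ j, (p j).natDegree = e j) (hp : ∀ j, (p j).Monic)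
    (hdeg' : ∀ j, (p' j).natDegree = e j) (hp' : ∀ j, (p' j).Monic) :
    Matrix.det (Matrix.of fun i j => φ i (p j)) = Matrix.det (Matrix.of fun i j => φ i (p' j)) := by
  have key : ∀ p : ι → R[X], (∀ j, (p j).natDegree = e j) → (∀ j, (p j).Monic) →
      Matrix.det (Matrix.of fun i j => φ i (p j)) =
        Matrix.det (Matrix.of fun i j : Fin n => φ (e.symm i) (X ^ (j : ℕ))) := by
    intro p hdeg hp
    rw [← det_linearMap_monic_eq (fun i => φ (e.symm i)) (fun j => p (e.symm j))
      (fun j => by simp [hdeg]) (fun j => hp _),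
      ← Matrix.det_submatrix_equiv_self e.symm (Matrix.of fun i j => φ i (p j))]
    rfl
  exact (key p hdeg hp).trans (key p' hdeg' hp').symm

/-- The position of `⟨i, l⟩` in the lexicographic enumeration of `Σ i, Fin (n i)`. -/
def lexIndex {m : ℕ} (n : Fin m → ℕ) (s : Σ i, Fin (n i)) : ℕ :=
  (∑ i ∈ Finset.Iio s.1, n i) + (s.2 : ℕ)

theorem finSigmaFinEquiv_eq_lexIndex {m : ℕ} (n : Fin m → ℕ) (s : Σ i, Fin (n i)) :
    (finSigmaFinEquiv s : ℕ) = lexIndex n s := by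
  rw [finSigmaFinEquiv_apply, lexIndex]
  congr 1
  refine Finset.sum_bij' (fun a _ => Fin.castLE s.1.2.le a)
    (fun b hb => ⟨(b : ℕ), Fin.lt_def.1 (Finset.mem_Iio.1 hb)⟩) ?_ ?_ ?_ ?_ ?_
  · intro a _
    simp [Fin.lt_def]
  all_goals intros; simp

theorem det_sigma_eq_prod_diag {R : Type*} [CommRing R] {m : ℕ} (n : Fin m → ℕ)
    (M : Matrix (Σ i, Fin (n i)) (Σ i, Fin (n i)) R)
    (h : ∀ i i' (l : Fin (n i)) (l' : Fin (n i')), i < i' → M ⟨i, l⟩ ⟨i', l'⟩ = 0)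
    (h' : ∀ i (l l' : Fin (n i)), l < l' → M ⟨i, l⟩ ⟨i, l'⟩ = 0) :
    M.det = ∏ s, M s s := by
  let e : (Σₗ i, Fin (n i)) ≃ Σ i, Fin (n i) := ofLex
  have htri : (M.submatrix e e).IsLowerTriangular := by
    rintro ⟨i, l⟩ ⟨i', l'⟩ hlt
    replace hlt := Sigma.Lex.lt_def.1 (OrderDual.toDual_lt_toDual.1 hlt)
    rcases hlt with hi | ⟨hi, hl⟩
    · exact h _ _ _ _ hi
    · obtain rfl : i = i' := hi
      exact h' _ _ _ hl
  rw [← Matrix.det_submatrix_equiv_self e]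
  exact (Matrix.det_of_isLowerTriangular _ htri).trans (e.prod_comp fun s => M s s)

open Polynomial in
/-- The Newton basis attached to the nodes `μ i` taken with multiplicities `n i`. -/
noncomputable def newtonPoly {m : ℕ} (n : Fin m → ℕ) (μ : Fin m → ℝ) (s : Σ i, Fin (n i)) :
    ℝ[X] :=
  (∏ i ∈ Finset.Iio s.1, (X - C (μ i)) ^ n i) * (X - C (μ s.1)) ^ (s.2 : ℕ)

open Polynomial in
theorem monic_newtonPoly {m : ℕ} (n : Fin m → ℕ) (μ : Fin m → ℝ) (s : Σ i, Fin (n i)) :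
    (newtonPoly n μ s).Monic :=
  (monic_prod_of_monic _ _ fun i _ => (monic_X_sub_C (μ i)).pow _).mul ((monic_X_sub_C _).pow _)

open Polynomial in
theorem natDegree_newtonPoly {m : ℕ} (n : Fin m → ℕ) (μ : Fin m → ℝ) (s : Σ i, Fin (n i)) :
    (newtonPoly n μ s).natDegree = lexIndex n s := by
  rw [newtonPoly, Monic.natDegree_mul
    (monic_prod_of_monic _ _ fun i _ => (monic_X_sub_C (μ i)).pow _) ((monic_X_sub_C _).pow _),
    natDegree_prod_of_monic _ _ fun i _ => (monic_X_sub_C (μ i)).pow _]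
  simp [lexIndex, natDegree_pow]

open Polynomial in
/-- The functional `p ↦ p^{(l)}(μ i)` for `s = ⟨i, l⟩`. -/
noncomputable def jetEval {m : ℕ} (n : Fin m → ℕ) (μ : Fin m → ℝ) (s : Σ i, Fin (n i)) :
    ℝ[X] →ₗ[ℝ] ℝ :=
  leval (μ s.1) ∘ₗ (derivative ^ (s.2 : ℕ))

open Polynomial in
theorem jetEval_apply {m : ℕ} (n : Fin m → ℕ) (μ : Fin m → ℝ) (s : Σ i, Fin (n i)) (p : ℝ[X]) :
    jetEval n μ s p = (derivative^[(s.2 : ℕ)] p).eval (μ s.1) := by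
  simp [jetEval, Module.End.pow_apply]

open Polynomial in
theorem jetEval_eq_zero_of_dvd {m : ℕ} (n : Fin m → ℕ) (μ : Fin m → ℝ) (s : Σ i, Fin (n i))
    {k : ℕ} (hk : (s.2 : ℕ) < k) {p : ℝ[X]} (hp : (X - C (μ s.1)) ^ k ∣ p) :
    jetEval n μ s p = 0 := by
  obtain ⟨r, hr⟩ := hp
  rw [jetEval_apply]
  simpa using aeval_iterate_derivative_of_lt p k (μ s.1) (p' := r) (by simpa using hr) hk

/-- The confluent Vandermonde determinant of the nodes `μ i` with multiplicities `n i`. -/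
noncomputable def confluentVandermonde {m : ℕ} (n : Fin m → ℕ) (μ : Fin m → ℝ) : ℝ :=
  (∏ j, ∏ k ∈ Finset.Ioi j, (μ k - μ j) ^ (n j * n k)) *
    ∏ i, ∏ l : Fin (n i), ((l : ℕ).factorial : ℝ)

open Polynomial in
theorem det_jetEval_mul_newtonPoly {m : ℕ} (n : Fin m → ℕ) (μ : Fin m → ℝ) (Z : ℝ[X]) :
    Matrix.det (Matrix.of fun s t => jetEval n μ s (Z * newtonPoly n μ t)) =
      (∏ i, Z.eval (μ i) ^ n i) * confluentVandermonde n μ := by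
  have hdiag : ∀ s : Σ i, Fin (n i), jetEval n μ s (Z * newtonPoly n μ s) =
      ((s.2 : ℕ).factorial : ℝ) *
        (Z.eval (μ s.1) * ∏ i ∈ Finset.Iio s.1, (μ s.1 - μ i) ^ n i) := by
    intro s
    rw [jetEval_apply]
    have := aeval_iterate_derivative_self (Z * newtonPoly n μ s) (s.2 : ℕ) (μ s.1)
      (p' := Z * ∏ i ∈ Finset.Iio s.1, (X - C (μ i)) ^ n i)
      (by rw [newtonPoly, Algebra.algebraMap_self, Polynomial.map_id]; ring)
    simpa [eval_prod] using this
  rw [det_sigma_eq_prod_diag]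
  rotate_left
  · intro i i' l l' h
    refine jetEval_eq_zero_of_dvd n μ ⟨i, l⟩ l.2 (Dvd.dvd.mul_left (Dvd.dvd.mul_right ?_ _) _)
    exact Finset.dvd_prod_of_mem (fun i => (X - C (μ i)) ^ n i) (Finset.mem_Iio.2 h)
  · intro i l l' h
    exact jetEval_eq_zero_of_dvd n μ ⟨i, l⟩ (Fin.lt_def.1 h)
      (Dvd.dvd.mul_left (dvd_mul_left _ _) _)
  simp only [Matrix.of_apply]
  rw [Finset.prod_congr rfl fun s _ => hdiag s, Fintype.prod_sigma, confluentVandermonde]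
  simp only [Finset.prod_mul_distrib, Finset.prod_const, Finset.card_univ, Fintype.card_fin]
  have h2 : ∏ j, ∏ k ∈ Finset.Ioi j, (μ k - μ j) ^ (n j * n k) =
      ∏ k, (∏ j ∈ Finset.Iio k, (μ k - μ j) ^ n j) ^ n k := by
    simp only [← Finset.prod_pow, ← pow_mul]
    exact Finset.prod_comm' (by simp)
  rw [h2]
  ring

open Polynomial in
/-- Evaluation at the simple nodes `z`, followed by the jets at the nodes `μ`. -/
noncomputable def nodeEval {N m : ℕ} (z : Fin N → ℝ) (n : Fin m → ℕ) (μ : Fin m → ℝ) :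
    Fin N ⊕ (Σ i, Fin (n i)) → ℝ[X] →ₗ[ℝ] ℝ :=
  Sum.elim (fun k => leval (z k)) (jetEval n μ)

open Polynomial in
theorem det_nodeEval {N m : ℕ} (z : Fin N → ℝ) (n : Fin m → ℕ) (μ : Fin m → ℝ)
    (P : ℕ → ℝ[X]) (hmonic : ∀ k, (P k).Monic) (hdeg : ∀ k, (P k).natDegree = k) :
    Matrix.det (Matrix.of fun a b : Fin N ⊕ (Σ i, Fin (n i)) =>
        nodeEval z n μ a (P (Sum.elim (fun k : Fin N => (k : ℕ)) (fun s => N + lexIndex n s) b))) =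
      vandR z * (∏ l, ∏ i, (μ i - z l) ^ n i) * confluentVandermonde n μ := by
  have hZ : (∏ l, (X - C (z l))).Monic := monic_prod_of_monic _ _ fun l _ => monic_X_sub_C _
  rw [det_linearMap_monic_congr
    ((Equiv.sumCongr (Equiv.refl (Fin N)) finSigmaFinEquiv).trans finSumFinEquiv)
    (nodeEval z n μ) _
    (Sum.elim (fun k : Fin N => P k) (fun s => (∏ l, (X - C (z l))) * newtonPoly n μ s))]
  · have : (Matrix.of fun a b : Fin N ⊕ (Σ i, Fin (n i)) => nodeEval z n μ a
        (Sum.elim (fun k : Fin N => P k)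
          (fun s => (∏ l, (X - C (z l))) * newtonPoly n μ s) b)) =
        Matrix.fromBlocks (Matrix.of fun l k : Fin N => (P k).eval (z l)) 0
          (Matrix.of fun s (k : Fin N) => jetEval n μ s (P k))
          (Matrix.of fun s t => jetEval n μ s ((∏ l, (X - C (z l))) * newtonPoly n μ t)) := by
      ext (l | s) (k | t)
      · simp [nodeEval]
      · have : ∏ l', (z l - z l') = 0 := Finset.prod_eq_zero (Finset.mem_univ l) (sub_self _)
        simp [nodeEval, eval_prod, this]
      · simp [nodeEval]
      · simp [nodeEval]
    rw [this, Matrix.det_fromBlocks_zero₁₂, det_jetEval_mul_newtonPoly,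
      ← Matrix.det_eval_matrixOfPolynomials_eq_det_vandermonde z (fun k => P k)
        (fun k => hdeg k) (fun k => hmonic k), Matrix.det_vandermonde, vandR, mul_assoc]
    congr 2
    rw [Finset.prod_comm]
    simp [eval_prod, Finset.prod_pow]
  · rintro (k | s) <;> simp [hdeg, ← finSigmaFinEquiv_eq_lexIndex]
  · exact fun _ => hmonic _
  · rintro (k | s)
    · simp [hdeg]
    · simp only [Sum.elim_inr]
      rw [hZ.natDegree_mul (monic_newtonPoly n μ s), natDegree_newtonPoly,
        natDegree_prod_of_monic _ _ fun l _ => monic_X_sub_C _]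
      simp [← finSigmaFinEquiv_eq_lexIndex]
  · rintro (k | s)
    · exact hmonic _
    · exact hZ.mul (monic_newtonPoly n μ s)

section RowIntegration

variable {N : ℕ} {κ : Type*} [Fintype κ] [DecidableEq κ] (ν : Measure ℝ) [SigmaFinite ν]
  (g : Fin N → Fin N ⊕ κ → ℝ → ℝ) (A : κ → Fin N ⊕ κ → ℝ)

theorem det_sumElim_apply (z : Fin N → ℝ) :
    Matrix.det (Matrix.of (Sum.elim (fun k b => g k b (z k)) A)) =
      ∑ σ : Equiv.Perm (Fin N ⊕ κ), ((Equiv.Perm.sign σ : ℤ) : ℝ) *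
        ((∏ s, A s (σ (Sum.inr s))) * ∏ k, g k (σ (Sum.inl k)) (z k)) := by
  rw [← Matrix.det_transpose, Matrix.det_apply']
  refine Finset.sum_congr rfl fun σ _ => ?_
  rw [Fintype.prod_sum_type, mul_comm (∏ s, A s _)]
  rfl

theorem integrable_det_sumElim (hg : ∀ k b, Integrable (g k b) ν) :
    Integrable (fun z : Fin N → ℝ =>
      Matrix.det (Matrix.of (Sum.elim (fun k b => g k b (z k)) A))) (Measure.pi fun _ => ν) := by
  simp only [det_sumElim_apply]
  exact integrable_finsetSum _ fun σ _ =>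
    ((Integrable.fintype_prod fun k => hg k _).const_mul _).const_mul _

/-- A determinant whose rows depend on separate variables may be integrated row by row. -/
theorem integral_det_sumElim (hg : ∀ k b, Integrable (g k b) ν) :
    ∫ z : Fin N → ℝ, Matrix.det (Matrix.of (Sum.elim (fun k b => g k b (z k)) A))
        ∂(Measure.pi fun _ => ν) =
      Matrix.det (Matrix.of (Sum.elim (fun k b => ∫ x, g k b x ∂ν) A)) := by
  have h := det_sumElim_apply (N := N) (fun k b _ => ∫ x, g k b x ∂ν) A 0
  simp only [det_sumElim_apply, h]
  rw [integral_finsetSum _ fun σ _ =>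
    ((Integrable.fintype_prod fun k => hg k _).const_mul _).const_mul _]
  simp only [integral_const_mul, integral_fintype_prod_eq_prod]

end RowIntegration

theorem vandR_eq_sum_perm {N : ℕ} (z : Fin N → ℝ) (P : ℕ → Polynomial ℝ)
    (hmonic : ∀ k, (P k).Monic) (hdeg : ∀ k, (P k).natDegree = k) :
    vandR z = ∑ τ : Equiv.Perm (Fin N), ((Equiv.Perm.sign τ : ℤ) : ℝ) *
      ∏ k, (P (τ k)).eval (z k) := by
  rw [vandR, ← Matrix.det_vandermonde,
    Matrix.det_eval_matrixOfPolynomials_eq_det_vandermonde z (fun k => P k)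
      (fun k => hdeg k) (fun k => hmonic k), ← Matrix.det_transpose, Matrix.det_apply']
  rfl

theorem integrable_mul_eval (ν : Measure ℝ) (ω : ℝ → ℝ)
    (hmom : ∀ n : ℕ, Integrable (fun x => ω x * |x| ^ n) ν) (p : Polynomial ℝ) :
    Integrable (fun x => ω x * p.eval x) ν := by
  have hω : AEStronglyMeasurable ω ν := by simpa using (hmom 0).aestronglyMeasurable
  simp only [Polynomial.eval_eq_sum_range, Finset.mul_sum]
  refine integrable_finsetSum _ fun n _ => ?_
  refine ((hmom n).const_mul |p.coeff n|).mono (by fun_prop) (ae_of_all _ fun x => ?_)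
  simp only [Real.norm_eq_abs, abs_mul, abs_pow, abs_abs]
  exact le_of_eq (by ring)

/-- Integrating the Vandermonde product against a bordered determinant of orthogonal polynomials
leaves the determinant of the border. -/
theorem integral_vandR_mul_det {N : ℕ} {κ : Type*} [Fintype κ] [DecidableEq κ]
    (ν : Measure ℝ) [SigmaFinite ν] (ω : ℝ → ℝ)
    (hmom : ∀ n : ℕ, Integrable (fun x => ω x * |x| ^ n) ν)
    (P : ℕ → Polynomial ℝ) (hmonic : ∀ k, (P k).Monic) (hdeg : ∀ k, (P k).natDegree = k)
    (horth : ∀ j k, j ≠ k → (∫ x, ω x * ((P j).eval x * (P k).eval x) ∂ν) = 0)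
    (d : κ → ℕ) (A : κ → Fin N ⊕ κ → ℝ) :
    ∫ z : Fin N → ℝ, vandR z * (∏ l, ω (z l)) *
        Matrix.det (Matrix.of (Sum.elim
          (fun k b => (P (Sum.elim (fun k : Fin N => (k : ℕ)) (fun s => N + d s) b)).eval (z k)) A))
        ∂(Measure.pi fun _ => ν) =
      N.factorial * (∏ k : Fin N, ∫ x, ω x * ((P k).eval x * (P k).eval x) ∂ν) *
        Matrix.det (Matrix.of fun s t => A s (Sum.inr t)) := by
  set D : Fin N ⊕ κ → ℕ := Sum.elim (fun k : Fin N => (k : ℕ)) (fun s => N + d s) with hD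
  let g (τ : Equiv.Perm (Fin N)) (k : Fin N) (b : Fin N ⊕ κ) (x : ℝ) : ℝ :=
    ω x * ((P (τ k)).eval x * (P (D b)).eval x)
  have hg : ∀ τ k b, Integrable (g τ k b) ν := fun τ k b => by
    simpa using integrable_mul_eval ν ω hmom (P (τ k) * P (D b))
  have hrow : ∀ τ (z : Fin N → ℝ),
      Matrix.det (Matrix.of (Sum.elim (fun k b => g τ k b (z k)) A)) =
      (∏ k, (P (τ k)).eval (z k)) * (∏ l, ω (z l)) *
        Matrix.det (Matrix.of (Sum.elim (fun k b => (P (D b)).eval (z k)) A)) := by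
    intro τ z
    have := Matrix.det_mul_column
      (Sum.elim (fun k => (P (τ k)).eval (z k) * ω (z k)) (fun _ : κ => (1 : ℝ)))
      (Matrix.of (Sum.elim (fun k b => (P (D b)).eval (z k)) A))
    rw [Fintype.prod_sum_type] at this
    simp only [Sum.elim_inl, Sum.elim_inr, Finset.prod_const_one, mul_one,
      Finset.prod_mul_distrib] at this
    rw [← this]
    congr 1
    ext (k | s) b
    · simp only [g, Matrix.of_apply, Sum.elim_inl]
      ring
    · simp
  have hsplit : ∀ z : Fin N → ℝ, vandR z * (∏ l, ω (z l)) *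
        Matrix.det (Matrix.of (Sum.elim (fun k b => (P (D b)).eval (z k)) A)) =
      ∑ τ : Equiv.Perm (Fin N), ((Equiv.Perm.sign τ : ℤ) : ℝ) *
        Matrix.det (Matrix.of (Sum.elim (fun k b => g τ k b (z k)) A)) := by
    intro z
    rw [vandR_eq_sum_perm z P hmonic hdeg, Finset.sum_mul, Finset.sum_mul]
    refine Finset.sum_congr rfl fun τ _ => ?_
    rw [hrow]
    ring
  set h : Fin N → ℝ := fun k => ∫ x, ω x * ((P k).eval x * (P k).eval x) ∂ν with hh
  have hdet : ∀ τ : Equiv.Perm (Fin N),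
      Matrix.det (Matrix.of (Sum.elim (fun k b => ∫ x, g τ k b x ∂ν) A)) =
        ((Equiv.Perm.sign τ : ℤ) : ℝ) * (∏ k, h k) *
          Matrix.det (Matrix.of fun s t => A s (Sum.inr t)) := by
    intro τ
    have hblock : Matrix.of (Sum.elim (fun k b => ∫ x, g τ k b x ∂ν) A) =
        Matrix.fromBlocks ((Matrix.diagonal h).submatrix τ id) 0
          (Matrix.of fun s k => A s (Sum.inl k)) (Matrix.of fun s t => A s (Sum.inr t)) := by
      ext (k | s) (j | t)
      · simp only [Matrix.of_apply, Sum.elim_inl, Matrix.fromBlocks_apply₁₁, Matrix.submatrix_apply,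
          id, Matrix.diagonal_apply, g, hD]
        split_ifs with hkj
        · rw [hkj]
        · exact horth _ _ fun H => hkj (Fin.ext H)
      · exact horth _ _ (by simp only [hD, Sum.elim_inr]; have := (τ k).2; omega)
      · rfl
      · rfl
    rw [hblock, Matrix.det_fromBlocks_zero₁₂, Matrix.det_permute, Matrix.det_diagonal]
  simp only [hsplit]
  rw [integral_finsetSum _ fun τ _ => (integrable_det_sumElim ν (g τ) A (hg τ)).const_mul _]
  simp only [integral_const_mul, integral_det_sumElim ν _ A (hg _), hdet]
  have hsq : ∀ τ : Equiv.Perm (Fin N),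
      ((Equiv.Perm.sign τ : ℤ) : ℝ) * ((Equiv.Perm.sign τ : ℤ) : ℝ) = 1 := fun τ => by
    rw [← Int.cast_mul, ← Units.val_mul, Int.units_mul_self]
    simp
  simp only [← mul_assoc, hsq, one_mul, Finset.sum_const, Finset.card_univ, Fintype.card_perm,
    Fintype.card_fin, nsmul_eq_mul]

/-- The averaged product of characteristic polynomials at the nodes `μ i` with multiplicities `n i`,
without normalisation. -/
theorem integral_vandR_sq_mul_confluentVandermonde {N m : ℕ} (Ω : Set ℝ) (ω : ℝ → ℝ)
    (hmom : ∀ n : ℕ, IntegrableOn (fun x => ω x * |x| ^ n) Ω)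
    (P : ℕ → Polynomial ℝ) (hmonic : ∀ k, (P k).Monic) (hdeg : ∀ k, (P k).natDegree = k)
    (horth : ∀ j k, j ≠ k → (∫ x in Ω, ω x * ((P j).eval x * (P k).eval x)) = 0)
    (n : Fin m → ℕ) (μ : Fin m → ℝ) :
    (∫ z in Set.univ.pi (fun _ : Fin N => Ω),
        vandR z ^ 2 * (∏ l, ω (z l)) * ∏ l, ∏ i, (μ i - z l) ^ n i) * confluentVandermonde n μ =
      N.factorial * (∏ k : Fin N, ∫ x in Ω, ω x * ((P k).eval x * (P k).eval x)) *
        Matrix.det (Matrix.of fun s t => jetEval n μ s (P (N + lexIndex n t))) := by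
  rw [volume_pi, Measure.restrict_pi_pi, ← integral_mul_const]
  refine Eq.trans ?_ (integral_vandR_mul_det _ ω hmom P hmonic hdeg horth (lexIndex n) (fun s b =>
    jetEval n μ s (P (Sum.elim (fun k : Fin N => (k : ℕ)) (fun s => N + lexIndex n s) b))))
  refine integral_congr_ae (ae_of_all _ fun z => ?_)
  have h : Matrix.of (Sum.elim (fun (k : Fin N) b =>
      (P (Sum.elim (fun k : Fin N => (k : ℕ)) (fun s => N + lexIndex n s) b)).eval (z k))
      (fun s b => jetEval n μ s
        (P (Sum.elim (fun k : Fin N => (k : ℕ)) (fun s => N + lexIndex n s) b)))) =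
      Matrix.of fun a b : Fin N ⊕ (Σ i, Fin (n i)) => nodeEval z n μ a
        (P (Sum.elim (fun k : Fin N => (k : ℕ)) (fun s => N + lexIndex n s) b)) := by
    ext (k | s) b <;> rfl
  simp only [h, det_nodeEval z n μ P hmonic hdeg]
  ring

theorem confluentVandermonde_ne_zero {m : ℕ} (n : Fin m → ℕ) {μ : Fin m → ℝ}
    (hμ : Function.Injective μ) : confluentVandermonde n μ ≠ 0 := by
  refine mul_ne_zero (Finset.prod_ne_zero_iff.2 fun j _ => Finset.prod_ne_zero_iff.2 fun k hk =>
    pow_ne_zero _ (sub_ne_zero.2 (hμ.ne (Finset.mem_Ioi.1 hk).ne'))) ?_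
  exact Finset.prod_ne_zero_iff.2 fun i _ => Finset.prod_ne_zero_iff.2 fun l _ =>
    Nat.cast_ne_zero.2 (Nat.factorial_ne_zero _)

theorem iteratedDeriv_eval (p : Polynomial ℝ) (l : ℕ) :
    iteratedDeriv l (fun x => p.eval x) = fun x => (Polynomial.derivative^[l] p).eval x := by
  induction l generalizing p with
  | zero => simp
  | succ l ih =>
    rw [iteratedDeriv_succ']
    have : deriv (fun x => p.eval x) = fun x => (Polynomial.derivative p).eval x :=
      funext fun x => p.deriv
    rw [this, ih, Function.iterate_succ_apply]

/-- Dividing all functions by `ζ` multiplies a determinant of jets by powers of `ζ⁻¹`. -/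
theorem det_iteratedDeriv_div {m : ℕ} (n : Fin m → ℕ) (μ : Fin m → ℝ) (ζ : ℝ → ℝ)
    (hζ : ContDiff ℝ (⊤ : ℕ∞) ζ) (hζ0 : ∀ x, ζ x ≠ 0)
    (p : (Σ i, Fin (n i)) → Polynomial ℝ) :
    Matrix.det (Matrix.of fun s t : Σ i, Fin (n i) =>
        iteratedDeriv (s.2 : ℕ) (fun x => (p t).eval x / ζ x) (μ s.1)) =
      (∏ i, (ζ (μ i) ^ n i)⁻¹) * Matrix.det (Matrix.of fun s t => jetEval n μ s (p t)) := by
  let W (i : Fin m) : Matrix (Fin (n i)) (Fin (n i)) ℝ := Matrix.of fun l k =>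
    ((l : ℕ).choose k : ℝ) * iteratedDeriv ((l : ℕ) - k) (fun x => (ζ x)⁻¹) (μ i)
  have hW : (Matrix.blockDiagonal' W).det = ∏ i, (ζ (μ i) ^ n i)⁻¹ := by
    rw [det_sigma_eq_prod_diag, Fintype.prod_sigma]
    · simp [W, Matrix.blockDiagonal'_apply_eq]
    · exact fun i i' l l' h => Matrix.blockDiagonal'_apply_ne _ _ _ h.ne
    · intro i l l' h
      rw [Matrix.blockDiagonal'_apply_eq]
      simp [W, Nat.choose_eq_zero_of_lt (Fin.lt_def.1 h)]
  have hmul : (Matrix.of fun s t : Σ i, Fin (n i) =>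
        iteratedDeriv (s.2 : ℕ) (fun x => (p t).eval x / ζ x) (μ s.1)) =
      Matrix.blockDiagonal' W * Matrix.of fun s t => jetEval n μ s (p t) := by
    ext ⟨i, l⟩ t
    have hp : ContDiffAt ℝ (l : ℕ) (fun x => (p t).eval x) (μ i) :=
      by
      simpa using ((p t).contDiff_aeval (l : ℕ) (𝕜 := ℝ)).contDiffAt
    have hi : ContDiffAt ℝ (l : ℕ) (fun x => (ζ x)⁻¹) (μ i) :=
      ((hζ.inv hζ0).of_le (by exact_mod_cast le_top)).contDiffAt
    rw [Matrix.mul_apply, Fintype.sum_sigma, Finset.sum_eq_single i]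
    · simp only [Matrix.of_apply, div_eq_mul_inv, Matrix.blockDiagonal'_apply_eq, W, jetEval_apply,
        iteratedDeriv_fun_mul hp hi, iteratedDeriv_eval]
      rw [Fin.sum_univ_eq_sum_range (fun k => ((l : ℕ).choose k : ℝ) *
        iteratedDeriv ((l : ℕ) - k) (fun x => (ζ x)⁻¹) (μ i) *
        (Polynomial.derivative^[k] (p t)).eval (μ i))]
      have hsub : Finset.range ((l : ℕ) + 1) ⊆ Finset.range (n i) :=
        Finset.range_subset_range.2 l.2
      rw [← Finset.sum_subset hsub]
      · exact Finset.sum_congr rfl fun k _ => by ring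
      · intro k _ hk
        have : (l : ℕ) < k := by simpa using hk
        simp [Nat.choose_eq_zero_of_lt this]
    · intro j _ hj
      exact Finset.sum_eq_zero fun k _ => by
        rw [Matrix.blockDiagonal'_apply_ne _ _ _ hj.symm, zero_mul]
    · simp
  rw [hmul, Matrix.det_mul, hW]

/-- confluent form of the Brézin–Hikami identity.
With `r_{N+j-1} = π^{(N)}_{N+j-1}/ζ_N`,
`H_{N,N,m,q}(μ)/H_{N,N} = ∏_{j<k}(μ_k-μ_j)^{-4q_jq_k} ∏_i ζ_N(μ_i)^{2q_i}/∏_{l=1}^{2q_i-1} l!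
  · det D`,
where `D` has rows `j = 1,…,2|q|` and columns indexed lexicographically by pairs
`(i, l_i)` (both encoded by the sigma type `Σ i, Fin (2 q i)`, a row `⟨i,l⟩`
corresponding to `j - 1 = τ(i) + l`), with `((i,l_i),j)` entry
`d^{l_i-1}/dμ_i^{l_i-1} r_{N+j-1}(μ_i)`. -/
theorem confluent_brezin_hikami
    (Ω : Set ℝ) (hΩ : MeasurableSet Ω) (N : ℕ) (ω : ℝ → ℝ)
    (hω : Measurable ω) (hωpos : ∀ x ∈ Ω, 0 < ω x)
    (hmom : ∀ n : ℕ, IntegrableOn (fun x => ω x * |x| ^ n) Ω)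
    (P : ℕ → Polynomial ℝ)
    (hmonic : ∀ k, (P k).Monic) (hdeg : ∀ k, (P k).natDegree = k)
    (horth : ∀ j k, j ≠ k → (∫ x in Ω, ω x * ((P j).eval x * (P k).eval x)) = 0)
    (m : ℕ) (hm : 1 ≤ m) (q : Fin m → ℕ) (hq : ∀ i, 1 ≤ q i)
    (ζ : ℝ → ℝ) (hζ : ContDiff ℝ (⊤ : ℕ∞) ζ) (hζ0 : ∀ x, ζ x ≠ 0)
    (μ : Fin m → ℝ) (hμ : Function.Injective μ)
    (hHpos : 0 < ∫ x in Set.univ.pi (fun _ : Fin N => Ω),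
        vandR x ^ 2 * ∏ l, ω (x l)) :
    (∫ z in Set.univ.pi (fun _ : Fin N => Ω),
        vandR z ^ 2 * (∏ l, ω (z l)) * ∏ l, ∏ i, |μ i - z l| ^ (2 * q i)) /
      (∫ x in Set.univ.pi (fun _ : Fin N => Ω), vandR x ^ 2 * ∏ l, ω (x l))
    = (∏ j : Fin m, ∏ k ∈ Finset.Ioi j,
          (μ k - μ j) ^ (-(4 * (q j : ℤ) * (q k : ℤ)))) *
      (∏ i, ζ (μ i) ^ (2 * q i) / ∏ l ∈ Finset.Icc 1 (2 * q i - 1), (l.factorial : ℝ)) *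
      Matrix.det (Matrix.of
        fun scol srow : Σ i : Fin m, Fin (2 * q i) =>
          iteratedDeriv (scol.2 : ℕ)
            (fun x : ℝ =>
              (P (N + ((∑ i' ∈ Finset.Iio srow.1, 2 * q i') + (srow.2 : ℕ)))).eval x / ζ x)
            (μ scol.1)) := by
  have key := integral_vandR_sq_mul_confluentVandermonde (N := N) Ω ω hmom P hmonic hdeg horth
    (fun i => 2 * q i) μ
  have key0 := integral_vandR_sq_mul_confluentVandermonde (N := N) Ω ω hmom P hmonic hdeg horth
    (m := 0) Fin.elim0 Fin.elim0
  have hV := confluentVandermonde_ne_zero (fun i => 2 * q i) hμ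
  simp only [confluentVandermonde, Finset.univ_eq_empty, Finset.prod_empty, Finset.prod_const_one,
    mul_one, Matrix.det_isEmpty] at key0
  have habs : ∀ z : Fin N → ℝ, (∏ l, ∏ i, |μ i - z l| ^ (2 * q i)) =
      ∏ l, ∏ i, (μ i - z l) ^ (2 * q i) := fun z => by
    simp only [pow_mul, sq_abs]
  simp only [habs]
  rw [← key0] at key
  have hdiv := det_iteratedDeriv_div (fun i => 2 * q i) μ ζ hζ hζ0
    (fun t => P (N + lexIndex (fun i => 2 * q i) t))
  unfold lexIndex at hdiv key
  rw [hdiv, div_eq_iff hHpos.ne', ← mul_left_inj' hV, key]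
  have hfact : ∏ i, ∏ l ∈ Finset.Icc 1 (2 * q i - 1), (l.factorial : ℝ) =
      ∏ i, ∏ l : Fin (2 * q i), ((l : ℕ).factorial : ℝ) := by
    refine Finset.prod_congr rfl fun i _ => ?_
    obtain ⟨M, hM⟩ : ∃ M, 2 * q i = M + 1 := ⟨2 * q i - 1, by have := hq i; omega⟩
    rw [Fin.prod_univ_eq_prod_range (fun l => (l.factorial : ℝ)), hM, Nat.add_sub_cancel,
      Finset.prod_range_succ', ← Finset.Ico_add_one_right_eq_Icc, Finset.prod_Ico_eq_prod_range]
    simp [add_comm]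
  have hpow : ∏ j : Fin m, ∏ k ∈ Finset.Ioi j, (μ k - μ j) ^ (-(4 * (q j : ℤ) * (q k : ℤ))) =
      (∏ j : Fin m, ∏ k ∈ Finset.Ioi j, (μ k - μ j) ^ (2 * q j * (2 * q k)))⁻¹ := by
    simp only [← Finset.prod_inv_distrib]
    refine Finset.prod_congr rfl fun j _ => Finset.prod_congr rfl fun k _ => ?_
    rw [zpow_neg, ← zpow_natCast]
    congr 2
    push_cast
    ring
  have hζp : ∏ i, ζ (μ i) ^ (2 * q i) ≠ 0 :=
    Finset.prod_ne_zero_iff.2 fun i _ => pow_ne_zero _ (hζ0 _)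
  rw [Finset.prod_div_distrib, hfact, hpow, Finset.prod_inv_distrib]
  rw [confluentVandermonde] at hV ⊢
  obtain ⟨h1, h2⟩ := mul_ne_zero_iff.1 hV
  field_simp
end
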